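/- Let μ, α, β, σ > 0 and r > 3. There exists a constant C > 0, depending only on μ, α, β, σ, r, such that the following holds. Let y : ℝ → ℝ be continuous; for m = 1, 2 let f_m : ℝ × ℝ³ → ℝ³ be continuous with ∫_{ℝ³}|f_m(t,x)|² dx < ∞ for every t, let u_m : ℝ × ℝ³ → ℝ³ be smooth with, for each bounded time interval, a single compact set K ⊂ ℝ³ containing the support of u_m(t,·) for all t in that interval, let u_m(t,·) be divergence-free (∑_{i=1}^{3} ∂(u_m)ᵢ/∂xᵢ ≡ 0) for every t, and let p_m : ℝ × ℝ³ → ℝ be continuously differentiable in x, such that ∂u_m/∂t − μΔu_m + e^{y(t)}(u_m·∇)u_m + αu_m + βe^{(r−1)y(t)}|u_m|^{r−1}u_m = −e^{−y(t)}∇p_m + e^{−y(t)}f_m + σ y(t) u_m holds pointwise on ℝ × ℝ³. Then the function D(t) := ∫_{ℝ³}|u_1(t,x) − u_2(t,x)|² dx is differentiable and for every t: D′(t) ≤ C ( e^{−2y(t)} + |y(t)| + 1 ) D(t) + C ∫_{ℝ³}|f_1(t,x) − f_2(t,x)|² dx. -/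

import Mathlib

open MeasureTheory Filter

noncomputable section

/-- ℝ³ as a Euclidean space. -/
abbrev E3 : Type := EuclideanSpace ℝ (Fin 3)

/-- Partial derivative `∂g/∂xᵢ` of a scalar function on ℝ³. -/
def pd (i : Fin 3) (g : E3 → ℝ) (x : E3) : ℝ :=
  fderiv ℝ g x (EuclideanSpace.single i 1)

/-- The Laplacian of a scalar function on ℝ³. -/
def lap (g : E3 → ℝ) (x : E3) : ℝ :=
  ∑ i : Fin 3, pd i (fun y => pd i g y) x

/-- The hypotheses on a classical spatially compactly supported solution `(u, p)` of
the transformed 3D stochastic CBF equations (3.1) with multiplicative noise, with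
data `μ, α, β, σ, r`, Ornstein–Uhlenbeck path `y` and forcing `f`. -/
def IsSol (μ α β σ r : ℝ) (y : ℝ → ℝ) (f : ℝ → E3 → E3)
    (u : ℝ → E3 → E3) (p : ℝ → E3 → ℝ) : Prop :=
  ContDiff ℝ (⊤ : ℕ∞) (fun q : ℝ × E3 => u q.1 q.2) ∧
  (∀ a b : ℝ, ∃ K : Set E3, IsCompact K ∧
    ∀ t ∈ Set.Icc a b, ∀ x : E3, x ∉ K → u t x = 0) ∧
  (∀ t x, (∑ i : Fin 3, pd i (fun y' => u t y' i) x) = 0) ∧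
  (∀ t, ContDiff ℝ 1 (p t)) ∧
  (∀ (t : ℝ) (x : E3) (j : Fin 3),
    deriv (fun s => u s x j) t - μ * lap (fun y' => u t y' j) x
      + Real.exp (y t) * (∑ i : Fin 3, u t x i * pd i (fun y' => u t y' j) x)
      + α * u t x j
      + β * Real.exp ((r - 1) * y t) * (‖u t x‖ ^ (r - 1) * u t x j)
    = -(Real.exp (-(y t)) * pd j (p t) x) + Real.exp (-(y t)) * f t x j
      + σ * y t * u t x j)

/-- Differentiation under the integral sign for a `C¹` integrand whose spatial support is locally
uniformly compact in time. -/
lemma hasDerivAt_integral_of_contDiff_of_compact {E : Type*} [NormedAddCommGroup E]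
    [NormedSpace ℝ E] [MeasurableSpace E] [BorelSpace E] {ν : Measure E}
    [IsFiniteMeasureOnCompacts ν] {Φ : ℝ → E → ℝ} (hΦ : ContDiff ℝ 1 (Function.uncurry Φ))
    {t : ℝ} {K : Set E} (hK : IsCompact K)
    (hsupp : ∀ s ∈ Set.Icc (t - 1) (t + 1), ∀ x ∉ K, Φ s x = 0) :
    Integrable (fun x => deriv (fun s => Φ s x) t) ν ∧
      HasDerivAt (fun s => ∫ x, Φ s x ∂ν) (∫ x, deriv (fun s => Φ s x) t ∂ν) t := by
  have hderiv : ∀ s x, HasDerivAt (fun s => Φ s x)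
      (fderiv ℝ (Function.uncurry Φ) (s, x) (1, 0)) s := by
    intro s x
    have h1 := (hΦ.differentiable one_ne_zero (s, x)).hasFDerivAt
    exact h1.comp_hasDerivAt s ((hasDerivAt_id s).prodMk (hasDerivAt_const s x))
  have hcont : Continuous fun z : ℝ × E => fderiv ℝ (Function.uncurry Φ) z (1, 0) :=
    (hΦ.continuous_fderiv one_ne_zero).clm_apply continuous_const
  obtain ⟨M, hM⟩ := ((isCompact_Icc (a := t - 1) (b := t + 1)).prod hK).exists_bound_of_continuousOn
    hcont.continuousOn
  have hslice : ∀ s, Continuous (Φ s) := fun s =>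
    hΦ.continuous.comp (Continuous.prodMk_right s)
  have hball : ∀ s ∈ Metric.ball t 1, s ∈ Set.Ioo (t - 1) (t + 1) := fun s hs => by
    rwa [Real.ball_eq_Ioo] at hs
  have hdiff := hasDerivAt_integral_of_dominated_loc_of_deriv_le (μ := ν) (𝕜 := ℝ) (F := Φ)
    (F' := fun s x => fderiv ℝ (Function.uncurry Φ) (s, x) (1, 0)) (x₀ := t)
    (s := Metric.ball t 1) (bound := K.indicator fun _ => M)
    (Metric.ball_mem_nhds t one_pos)
    (.of_forall fun s => (hslice s).aestronglyMeasurable)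
    ((hslice t).integrable_of_hasCompactSupport
      (HasCompactSupport.intro hK fun x hx => hsupp t (by constructor <;> linarith) x hx))
    (hcont.comp (Continuous.prodMk_right t)).aestronglyMeasurable
    (.of_forall fun x s hs => by
      by_cases hx : x ∈ K
      · rw [Set.indicator_of_mem hx]
        exact hM (s, x) ⟨Set.Ioo_subset_Icc_self (hball s hs), hx⟩
      · have h0 : (fun s => Φ s x) =ᶠ[nhds s] fun _ => 0 := by
          filter_upwards [Ioo_mem_nhds (hball s hs).1 (hball s hs).2] with s' hs'
          exact hsupp s' (Set.Ioo_subset_Icc_self hs') x hx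
        rw [Set.indicator_of_notMem hx, ← (hderiv s x).deriv, h0.deriv_eq]
        simp)
    ((integrable_indicator_iff hK.measurableSet).2 (integrableOn_const hK.measure_lt_top.ne))
    (.of_forall fun x s _ => hderiv s x)
  simp_rw [fun x => (hderiv t x).deriv]
  exact hdiff

lemma continuous_pd {g : E3 → ℝ} (hg : ContDiff ℝ 1 g) (i : Fin 3) : Continuous (pd i g) :=
  (hg.continuous_fderiv one_ne_zero).clm_apply continuous_const

lemma contDiff_pd {g : E3 → ℝ} {m n : WithTop ℕ∞} (hg : ContDiff ℝ n g) (hmn : m + 1 ≤ n)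
    (i : Fin 3) : ContDiff ℝ m (pd i g) :=
  (hg.fderiv_right hmn).clm_apply contDiff_const

lemma hasLineDerivAt_pd {g : E3 → ℝ} (hg : ContDiff ℝ 1 g) (i : Fin 3) (x : E3) :
    HasLineDerivAt ℝ g (pd i g x) x (EuclideanSpace.single i 1) :=
  (hg.differentiable one_ne_zero x).hasFDerivAt.hasLineDerivAt _

lemma hasCompactSupport_pd {g : E3 → ℝ} (hg : HasCompactSupport g) (i : Fin 3) :
    HasCompactSupport (pd i g) :=
  hg.fderiv_apply ℝ _

lemma integrable_pd {g : E3 → ℝ} (hg : ContDiff ℝ 1 g) (hc : HasCompactSupport g) (i : Fin 3) :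
    Integrable (pd i g) :=
  (continuous_pd hg i).integrable_of_hasCompactSupport (hasCompactSupport_pd hc i)

lemma integral_pd_eq_zero {g : E3 → ℝ} (hg : ContDiff ℝ 1 g) (hc : HasCompactSupport g)
    (i : Fin 3) : ∫ x, pd i g x = 0 := by
  have h := integral_mul_fderiv_eq_neg_fderiv_mul_of_integrable (𝕜 := ℝ) (μ := volume)
    (f := fun _ : E3 => (1 : ℝ)) (g := g) (v := EuclideanSpace.single i 1) (by simp)
    (by simp only [one_mul]; exact integrable_pd hg hc i)
    (by simpa using hg.continuous.integrable_of_hasCompactSupport hc)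
    (fun _ _ => differentiableAt_const _)
    (fun x _ => hg.differentiable one_ne_zero x)
  simpa [pd] using h

/-- The flux whose divergence collects all terms of the energy balance for the difference of two
solutions that integrate to zero. -/
def energyFlux (μ η : ℝ) (A B : Fin 3 → E3 → ℝ) (q : E3 → ℝ) (i : Fin 3) (x : E3) : ℝ :=
  2 * (∑ j, (μ * ((A j x - B j x) * (pd i (A j) x - pd i (B j) x))
    - Real.exp η * (A i x * (A j x - B j x) ^ 2 / 2
      + (A i x - B i x) * (A j x - B j x) * B j x)))
    - 2 * Real.exp (-η) * ((A i x - B i x) * q x)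

section Flux

variable {μ η : ℝ} {A B : Fin 3 → E3 → ℝ} {q : E3 → ℝ}

lemma contDiff_energyFlux (hA : ∀ j, ContDiff ℝ 2 (A j)) (hB : ∀ j, ContDiff ℝ 2 (B j))
    (hq : ContDiff ℝ 1 q) (i : Fin 3) : ContDiff ℝ 1 (energyFlux μ η A B q i) := by
  have hA1 : ∀ j, ContDiff ℝ 1 (A j) := fun j => (hA j).of_le one_le_two
  have hB1 : ∀ j, ContDiff ℝ 1 (B j) := fun j => (hB j).of_le one_le_two
  have hdA : ∀ j, ContDiff ℝ 1 (pd i (A j)) := fun j => contDiff_pd (hA j) (by norm_num) i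
  have hdB : ∀ j, ContDiff ℝ 1 (pd i (B j)) := fun j => contDiff_pd (hB j) (by norm_num) i
  unfold energyFlux
  fun_prop

lemma hasCompactSupport_energyFlux (hA : ∀ j, HasCompactSupport (A j))
    (hB : ∀ j, HasCompactSupport (B j)) (i : Fin 3) :
    HasCompactSupport (energyFlux μ η A B q i) := by
  have hK : IsCompact (⋃ j, (tsupport (A j) ∪ tsupport (B j))) :=
    isCompact_iUnion fun j => (hA j).isCompact.union (hB j).isCompact
  refine HasCompactSupport.intro hK fun x hx => ?_
  simp only [Set.mem_iUnion, Set.mem_union, not_exists, not_or] at hx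
  have hA0 : ∀ j, A j x = 0 := fun j => image_eq_zero_of_notMem_tsupport (hx j).1
  have hB0 : ∀ j, B j x = 0 := fun j => image_eq_zero_of_notMem_tsupport (hx j).2
  simp [energyFlux, hA0, hB0]

lemma pd_energyFlux (hA : ∀ j, ContDiff ℝ 2 (A j)) (hB : ∀ j, ContDiff ℝ 2 (B j))
    (hq : ContDiff ℝ 1 q) (i : Fin 3) (x : E3) :
    pd i (energyFlux μ η A B q i) x =
      2 * (∑ j, (μ * ((pd i (A j) x - pd i (B j) x) ^ 2
          + (A j x - B j x) * (pd i (pd i (A j)) x - pd i (pd i (B j)) x))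
        - Real.exp η * (pd i (A i) x * (A j x - B j x) ^ 2 / 2
          + A i x * (A j x - B j x) * (pd i (A j) x - pd i (B j) x)
          + (pd i (A i) x - pd i (B i) x) * (A j x - B j x) * B j x
          + (A i x - B i x) * (pd i (A j) x - pd i (B j) x) * B j x
          + (A i x - B i x) * (A j x - B j x) * pd i (B j) x)))
        - 2 * Real.exp (-η) * ((pd i (A i) x - pd i (B i) x) * q x
          + (A i x - B i x) * pd i q x) := by
  have hdA : ∀ j, HasDerivAt _ _ _ := fun j =>
    hasLineDerivAt_pd ((hA j).of_le one_le_two) i x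
  have hdB : ∀ j, HasDerivAt _ _ _ := fun j =>
    hasLineDerivAt_pd ((hB j).of_le one_le_two) i x
  have hddA : ∀ j, HasDerivAt _ _ _ := fun j =>
    hasLineDerivAt_pd (contDiff_pd (m := 1) (hA j) (by norm_num) i) i x
  have hddB : ∀ j, HasDerivAt _ _ _ := fun j =>
    hasLineDerivAt_pd (contDiff_pd (m := 1) (hB j) (by norm_num) i) i x
  have hdq : HasDerivAt _ _ _ := hasLineDerivAt_pd hq i x
  have hG : HasDerivAt _ _ _ :=
    hasLineDerivAt_pd (contDiff_energyFlux (μ := μ) (η := η) hA hB hq i) i x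
  have hw : ∀ j, HasDerivAt _ _ _ := fun j => (hdA j).sub (hdB j)
  have key := ((HasDerivAt.fun_sum (u := Finset.univ) fun j _ =>
    (((hw j).mul ((hddA j).sub (hddB j))).const_mul μ).sub
      (((((hdA i).mul ((hw j).pow 2)).div_const 2).add
        (((hw i).mul (hw j)).mul (hdB j))).const_mul (Real.exp η))).const_mul 2).sub
      (((hw i).mul hdq).const_mul (2 * Real.exp (-η)))
  refine (hG.unique key).trans ?_
  simp only [Pi.sub_apply, Pi.mul_apply, Pi.pow_apply, zero_smul, add_zero]
  congr 2
  refine Finset.sum_congr rfl fun j _ => ?_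
  push_cast
  ring

end Flux

lemma norm_sq_eq_sum (v : E3) : ‖v‖ ^ 2 = ∑ j, v j ^ 2 := by
  simp [EuclideanSpace.norm_sq_eq]

/-- A quadratic is absorbed by any power of exponent larger than two, up to a constant. -/
lemma exists_mul_sq_le_mul_rpow_add {c d s : ℝ} (hc : 0 < c) (hd : 0 < d) (hs : 2 < s) :
    ∃ K, 0 ≤ K ∧ ∀ z, 0 ≤ z → c * z ^ 2 ≤ d * z ^ s + K := by
  set M : ℝ := (c / d) ^ (s - 2)⁻¹ with hM
  have hMpos : 0 < M := Real.rpow_pos_of_pos (by positivity) _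
  refine ⟨c * M ^ 2, by positivity, fun z hz => ?_⟩
  rcases le_total z M with h | h
  · have : 0 ≤ d * z ^ s := by positivity
    have : c * z ^ 2 ≤ c * M ^ 2 := by gcongr
    linarith
  · have hzpos := hMpos.trans_le h
    have h1 : c / d ≤ z ^ (s - 2) := by
      calc c / d = M ^ (s - 2) := by
            rw [hM, ← Real.rpow_mul (by positivity), inv_mul_cancel₀ (by linarith), Real.rpow_one]
        _ ≤ z ^ (s - 2) := Real.rpow_le_rpow hMpos.le h (by linarith)
    have h2 : z ^ s = z ^ (s - 2) * z ^ 2 := by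
      rw [← Real.rpow_natCast z 2, ← Real.rpow_add hzpos]
      norm_num
    have h3 : c ≤ d * z ^ (s - 2) := by
      rw [div_le_iff₀ hd] at h1
      linarith
    have h4 : c * z ^ 2 ≤ d * z ^ (s - 2) * z ^ 2 := by gcongr
    rw [h2]
    nlinarith [mul_nonneg hc.le (sq_nonneg M)]

/-- Quantitative monotonicity of `v ↦ ‖v‖ ^ s • v`. -/
lemma half_rpow_mul_norm_sub_sq_le {s : ℝ} (hs : 0 ≤ s) (a b : E3) :
    ‖b‖ ^ s / 2 * ‖a - b‖ ^ 2 ≤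
      ∑ j, (‖a‖ ^ s * a j - ‖b‖ ^ s * b j) * (a j - b j) := by
  have hmono : 0 ≤ (‖a‖ ^ s - ‖b‖ ^ s) * (‖a‖ ^ 2 - ‖b‖ ^ 2) := by
    rcases le_total ‖a‖ ‖b‖ with h | h
    · exact mul_nonneg_of_nonpos_of_nonpos
        (sub_nonpos.2 (Real.rpow_le_rpow (norm_nonneg _) h hs)) (sub_nonpos.2 (by gcongr))
    · exact mul_nonneg
        (sub_nonneg.2 (Real.rpow_le_rpow (norm_nonneg _) h hs)) (sub_nonneg.2 (by gcongr))
  have ha : 0 ≤ ‖a‖ ^ s * ‖a - b‖ ^ 2 := by positivity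
  generalize ‖a‖ ^ s = P at *
  generalize ‖b‖ ^ s = Q at *
  simp only [norm_sq_eq_sum, Fin.sum_univ_three, PiLp.sub_apply] at *
  nlinarith

/-- Pointwise form of the energy estimate for the non-divergence terms. -/
lemma energy_terms_le {μ α β σ r K η : ℝ} (hμ : 0 < μ) (hα : 0 < α) (hβ : 0 < β) (hσ : 0 < σ)
    (hr : 3 < r) (hK : 0 ≤ K)
    (hyoung : ∀ z, 0 ≤ z → 1 / (4 * μ) * z ^ 2 ≤ β / 2 * z ^ (r - 1) + K)
    (a b g : E3) (W : Fin 3 → Fin 3 → ℝ) :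
    2 * (-(μ * ∑ i, ∑ j, W i j ^ 2)
        + Real.exp η * ∑ i, ∑ j, (a i - b i) * W i j * b j
        - α * ‖a - b‖ ^ 2
        - β * Real.exp ((r - 1) * η) *
          ∑ j, (‖a‖ ^ (r - 1) * a j - ‖b‖ ^ (r - 1) * b j) * (a j - b j)
        + Real.exp (-η) * ∑ j, g j * (a j - b j) + σ * η * ‖a - b‖ ^ 2)
      ≤ (2 * K + 2 * σ + 1) * (Real.exp (-2 * η) + |η| + 1) * ‖a - b‖ ^ 2
        + (2 * K + 2 * σ + 1) * ‖g‖ ^ 2 := by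
  have hconv : Real.exp η * ∑ i, ∑ j, (a i - b i) * W i j * b j ≤
      μ * (∑ i, ∑ j, W i j ^ 2) + 1 / (4 * μ) * (Real.exp η * ‖b‖) ^ 2 * ‖a - b‖ ^ 2 := by
    have h1 : ∀ i j, Real.exp η * ((a i - b i) * W i j * b j) ≤
        μ * W i j ^ 2 + 1 / (4 * μ) * Real.exp η ^ 2 * ((a i - b i) ^ 2 * b j ^ 2) := by
      intro i j
      have h2 : μ * W i j ^ 2 + 1 / (4 * μ) * Real.exp η ^ 2 * ((a i - b i) ^ 2 * b j ^ 2)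
          - Real.exp η * ((a i - b i) * W i j * b j)
          = μ * (W i j - Real.exp η * (a i - b i) * b j / (2 * μ)) ^ 2 := by
        field_simp
        ring
      have h3 : 0 ≤ μ * (W i j - Real.exp η * (a i - b i) * b j / (2 * μ)) ^ 2 := by positivity
      linarith
    have h4 := Finset.sum_le_sum fun i (_ : i ∈ Finset.univ) =>
      Finset.sum_le_sum fun j (_ : j ∈ Finset.univ) => h1 i j
    simp only [Finset.sum_add_distrib, ← Finset.mul_sum, ← Finset.sum_mul] at h4
    rw [mul_pow, norm_sq_eq_sum, norm_sq_eq_sum]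
    simp only [PiLp.sub_apply]
    linarith
  have hexp : Real.exp ((r - 1) * η) * ‖b‖ ^ (r - 1) = (Real.exp η * ‖b‖) ^ (r - 1) := by
    rw [Real.mul_rpow (Real.exp_pos _).le (norm_nonneg _), mul_comm (r - 1), Real.exp_mul]
  have hdamp := mul_le_mul_of_nonneg_left
    (half_rpow_mul_norm_sub_sq_le (s := r - 1) (by linarith) a b)
    (by positivity : 0 ≤ β * Real.exp ((r - 1) * η))
  have hdamp' : β / 2 * (Real.exp η * ‖b‖) ^ (r - 1) * ‖a - b‖ ^ 2 ≤ β * Real.exp ((r - 1) * η) *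
      ∑ j, (‖a‖ ^ (r - 1) * a j - ‖b‖ ^ (r - 1) * b j) * (a j - b j) := by
    rw [← hexp]
    linarith
  have hy := mul_le_mul_of_nonneg_right
    (hyoung (Real.exp η * ‖b‖) (by positivity)) (sq_nonneg ‖a - b‖)
  have hforce : 2 * (Real.exp (-η) * ∑ j, g j * (a j - b j)) ≤
      Real.exp (-2 * η) * ‖a - b‖ ^ 2 + ‖g‖ ^ 2 := by
    have he : Real.exp (-2 * η) = Real.exp (-η) ^ 2 := by
      rw [← Real.exp_nat_mul]
      congr 1
      push_cast
      ring
    rw [he, norm_sq_eq_sum, norm_sq_eq_sum]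
    simp only [Fin.sum_univ_three, PiLp.sub_apply]
    nlinarith [sq_nonneg (Real.exp (-η) * (a 0 - b 0) - g 0),
      sq_nonneg (Real.exp (-η) * (a 1 - b 1) - g 1),
      sq_nonneg (Real.exp (-η) * (a 2 - b 2) - g 2)]
  have hnoise : σ * η * ‖a - b‖ ^ 2 ≤ σ * |η| * ‖a - b‖ ^ 2 := by
    gcongr
    exact le_abs_self η
  have hdrop : 0 ≤ α * ‖a - b‖ ^ 2 := by positivity
  have hslack : 0 ≤ ((2 * K + 2 * σ) * Real.exp (-2 * η) + (2 * K + 1) * |η| + (2 * σ + 1))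
      * ‖a - b‖ ^ 2 + (2 * K + 2 * σ) * ‖g‖ ^ 2 := by positivity
  linarith

section Solution

variable {μ α β σ r : ℝ} {y : ℝ → ℝ} {f : ℝ → E3 → E3} {u : ℝ → E3 → E3} {p : ℝ → E3 → ℝ}

lemma IsSol.contDiff_component (h : IsSol μ α β σ r y f u p) (t : ℝ) (j : Fin 3) :
    ContDiff ℝ 2 (fun x => u t x j) := by
  have h1 : ContDiff ℝ (⊤ : ℕ∞) (fun x => u t x) := h.1.comp (contDiff_prodMk_right t)
  exact contDiff_infty.1 ((EuclideanSpace.proj (𝕜 := ℝ) j).contDiff.comp h1) 2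

lemma IsSol.hasDerivAt_component (h : IsSol μ α β σ r y f u p) (t : ℝ) (x : E3) (j : Fin 3) :
    HasDerivAt (fun s => u s x j) (deriv (fun s => u s x j) t) t := by
  have h1 : ContDiff ℝ (⊤ : ℕ∞) (fun s => u s x) := h.1.comp (contDiff_prodMk_left x)
  have h2 : ContDiff ℝ (⊤ : ℕ∞) (fun s => u s x j) :=
    (EuclideanSpace.proj (𝕜 := ℝ) j).contDiff.comp h1
  exact (h2.differentiable (by simp) t).hasDerivAt

lemma IsSol.hasCompactSupport_component (h : IsSol μ α β σ r y f u p) (t : ℝ) (j : Fin 3) :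
    HasCompactSupport (fun x => u t x j) := by
  obtain ⟨K, hK, hsupp⟩ := h.2.1 t t
  exact HasCompactSupport.intro hK fun x hx => by simp [hsupp t (by simp) x hx]

/-- Pointwise energy balance for the difference of two solutions. -/
lemma IsSol.deriv_norm_sub_sq {f₁ f₂ u₁ u₂ : ℝ → E3 → E3} {p₁ p₂ : ℝ → E3 → ℝ}
    (h₁ : IsSol μ α β σ r y f₁ u₁ p₁) (h₂ : IsSol μ α β σ r y f₂ u₂ p₂) (t : ℝ) (x : E3) :
    deriv (fun s => ‖u₁ s x - u₂ s x‖ ^ 2) t =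
      (∑ i, pd i (energyFlux μ (y t) (fun j x => u₁ t x j) (fun j x => u₂ t x j)
        (fun x => p₁ t x - p₂ t x) i) x)
      + 2 * (-(μ * ∑ i, ∑ j,
          (pd i (fun x => u₁ t x j) x - pd i (fun x => u₂ t x j) x) ^ 2)
        + Real.exp (y t) * (∑ i, ∑ j, (u₁ t x i - u₂ t x i) *
          (pd i (fun x => u₁ t x j) x - pd i (fun x => u₂ t x j) x) * u₂ t x j)
        - α * ‖u₁ t x - u₂ t x‖ ^ 2
        - β * Real.exp ((r - 1) * y t) *
          (∑ j, (‖u₁ t x‖ ^ (r - 1) * u₁ t x j - ‖u₂ t x‖ ^ (r - 1) * u₂ t x j)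
            * (u₁ t x j - u₂ t x j))
        + Real.exp (-y t) * (∑ j, (f₁ t x - f₂ t x) j * (u₁ t x j - u₂ t x j))
        + σ * y t * ‖u₁ t x - u₂ t x‖ ^ 2) := by
  have hd : HasDerivAt (fun s => ‖u₁ s x - u₂ s x‖ ^ 2)
      (∑ j, 2 * (u₁ t x j - u₂ t x j) *
        (deriv (fun s => u₁ s x j) t - deriv (fun s => u₂ s x j) t)) t := by
    simp only [norm_sq_eq_sum, PiLp.sub_apply]
    refine HasDerivAt.fun_sum fun j _ => ?_
    simpa using ((h₁.hasDerivAt_component t x j).sub (h₂.hasDerivAt_component t x j)).fun_pow 2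
  have hp : ∀ i, pd i (fun x => p₁ t x - p₂ t x) x = pd i (p₁ t) x - pd i (p₂ t) x := by
    intro i
    unfold pd
    rw [fderiv_fun_sub ((h₁.2.2.2.1 t).differentiable one_ne_zero x)
      ((h₂.2.2.2.1 t).differentiable one_ne_zero x)]
    simp
  have e₁ := h₁.2.2.2.2 t x
  have e₂ := h₂.2.2.2.2 t x
  have d₁ := h₁.2.2.1 t x
  have d₂ := h₂.2.2.1 t x
  rw [hd.deriv]
  simp only [pd_energyFlux (h₁.contDiff_component t) (h₂.contDiff_component t)
    ((h₁.2.2.2.1 t).sub (h₂.2.2.2.1 t)), hp, norm_sq_eq_sum, PiLp.sub_apply]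
  unfold lap at e₁ e₂
  simp only [Fin.sum_univ_three] at *
  linear_combination 2 * (u₁ t x 0 - u₂ t x 0) * (e₁ 0 - e₂ 0)
    + 2 * (u₁ t x 1 - u₂ t x 1) * (e₁ 1 - e₂ 1)
    + 2 * (u₁ t x 2 - u₂ t x 2) * (e₁ 2 - e₂ 2)
    + (Real.exp (y t) * ((u₁ t x 0 - u₂ t x 0) ^ 2 + (u₁ t x 1 - u₂ t x 1) ^ 2
        + (u₁ t x 2 - u₂ t x 2) ^ 2)) * d₁
    + (2 * Real.exp (y t) * ((u₁ t x 0 - u₂ t x 0) * u₂ t x 0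
        + (u₁ t x 1 - u₂ t x 1) * u₂ t x 1 + (u₁ t x 2 - u₂ t x 2) * u₂ t x 2)
      + 2 * Real.exp (-y t) * (p₁ t x - p₂ t x)) * (d₁ - d₂)

end Solution

lemma integrable_norm_sub_sq {f g : E3 → E3} (hf : Continuous f) (hg : Continuous g)
    (hf2 : Integrable fun x => ‖f x‖ ^ 2) (hg2 : Integrable fun x => ‖g x‖ ^ 2) :
    Integrable fun x => ‖f x - g x‖ ^ 2 := by
  rw [← memLp_two_iff_integrable_sq_norm hf.aestronglyMeasurable] at hf2
  rw [← memLp_two_iff_integrable_sq_norm hg.aestronglyMeasurable] at hg2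
  exact (memLp_two_iff_integrable_sq_norm (hf.sub hg).aestronglyMeasurable).1 (hf2.sub hg2)

/-- Continuous-dependence differential inequality (3.24) underlying Proposition 3.5:
for `r > 3` there is `C > 0` (depending only on `μ, α, β, σ, r`) such that for two
classical solutions `u₁, u₂` with forcings `f₁, f₂`, the function
`D(t) = ∫|u₁(t) − u₂(t)|² dx` is differentiable and
`D′(t) ≤ C(e^{−2y(t)} + |y(t)| + 1) D(t) + C ∫|f₁(t) − f₂(t)|² dx`. -/
theorem stmt19 (μ α β σ r : ℝ) (hμ : 0 < μ) (hα : 0 < α) (hβ : 0 < β) (hσ : 0 < σ)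
    (hr : 3 < r) :
    ∃ C : ℝ, 0 < C ∧
      ∀ (y : ℝ → ℝ), Continuous y →
      ∀ (f₁ f₂ : ℝ → E3 → E3),
        Continuous (Function.uncurry f₁) → Continuous (Function.uncurry f₂) →
        (∀ t, Integrable (fun x : E3 => ‖f₁ t x‖ ^ 2)) →
        (∀ t, Integrable (fun x : E3 => ‖f₂ t x‖ ^ 2)) →
      ∀ (u₁ u₂ : ℝ → E3 → E3) (p₁ p₂ : ℝ → E3 → ℝ),
        IsSol μ α β σ r y f₁ u₁ p₁ → IsSol μ α β σ r y f₂ u₂ p₂ →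
      (∀ t : ℝ, DifferentiableAt ℝ (fun s => ∫ x : E3, ‖u₁ s x - u₂ s x‖ ^ 2) t) ∧
      ∀ t : ℝ,
        deriv (fun s => ∫ x : E3, ‖u₁ s x - u₂ s x‖ ^ 2) t
          ≤ C * (Real.exp (-2 * y t) + |y t| + 1) * (∫ x : E3, ‖u₁ t x - u₂ t x‖ ^ 2)
            + C * ∫ x : E3, ‖f₁ t x - f₂ t x‖ ^ 2 := by
  obtain ⟨K, hK, hyoung⟩ := exists_mul_sq_le_mul_rpow_add (c := 1 / (4 * μ)) (d := β / 2)
    (s := r - 1) (by positivity) (by positivity) (by linarith)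
  refine ⟨2 * K + 2 * σ + 1, by positivity, ?_⟩
  intro y _ f₁ f₂ hf₁ hf₂ hi₁ hi₂ u₁ u₂ p₁ p₂ h₁ h₂
  have hsmooth : ContDiff ℝ 1 (Function.uncurry fun s x => ‖u₁ s x - u₂ s x‖ ^ 2) :=
    ((h₁.1.sub h₂.1).norm_sq ℝ).of_le (by exact_mod_cast le_top)
  have hderiv : ∀ t, Integrable (fun x => deriv (fun s => ‖u₁ s x - u₂ s x‖ ^ 2) t) ∧
      HasDerivAt (fun s => ∫ x, ‖u₁ s x - u₂ s x‖ ^ 2)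
        (∫ x, deriv (fun s => ‖u₁ s x - u₂ s x‖ ^ 2) t) t := by
    intro t
    obtain ⟨K₁, hK₁, hs₁⟩ := h₁.2.1 (t - 1) (t + 1)
    obtain ⟨K₂, hK₂, hs₂⟩ := h₂.2.1 (t - 1) (t + 1)
    refine hasDerivAt_integral_of_contDiff_of_compact hsmooth (hK₁.union hK₂) fun s hs x hx => ?_
    rw [Set.mem_union, not_or] at hx
    simp [hs₁ s hs x hx.1, hs₂ s hs x hx.2]
  refine ⟨fun t => (hderiv t).2.differentiableAt, fun t => ?_⟩
  rw [(hderiv t).2.deriv]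
  have hG := contDiff_energyFlux (μ := μ) (η := y t) (h₁.contDiff_component t)
    (h₂.contDiff_component t) ((h₁.2.2.2.1 t).sub (h₂.2.2.2.1 t))
  have hGc := hasCompactSupport_energyFlux (μ := μ) (η := y t) (q := fun x => p₁ t x - p₂ t x)
    (h₁.hasCompactSupport_component t) (h₂.hasCompactSupport_component t)
  have hflux := integrable_finsetSum Finset.univ fun i _ => integrable_pd (hG i) (hGc i) i
  have hw : Integrable fun x => ‖u₁ t x - u₂ t x‖ ^ 2 := by
    obtain ⟨K₁, hK₁, hs₁⟩ := h₁.2.1 t t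
    obtain ⟨K₂, hK₂, hs₂⟩ := h₂.2.1 t t
    refine (hsmooth.continuous.comp (Continuous.prodMk_right t)).integrable_of_hasCompactSupport
      (HasCompactSupport.intro (hK₁.union hK₂) fun x hx => ?_)
    rw [Set.mem_union, not_or] at hx
    simp [hs₁ t (by simp) x hx.1, hs₂ t (by simp) x hx.2]
  have hg : Integrable fun x => ‖f₁ t x - f₂ t x‖ ^ 2 := integrable_norm_sub_sq
    (hf₁.comp (Continuous.prodMk_right t)) (hf₂.comp (Continuous.prodMk_right t)) (hi₁ t) (hi₂ t)
  have hrhs := (hw.const_mul ((2 * K + 2 * σ + 1) * (Real.exp (-2 * y t) + |y t| + 1))).fun_add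
    (hg.const_mul (2 * K + 2 * σ + 1))
  calc ∫ x, deriv (fun s => ‖u₁ s x - u₂ s x‖ ^ 2) t
      ≤ ∫ x, ((∑ i, pd i (energyFlux μ (y t) (fun j x => u₁ t x j) (fun j x => u₂ t x j)
            (fun x => p₁ t x - p₂ t x) i) x)
          + ((2 * K + 2 * σ + 1) * (Real.exp (-2 * y t) + |y t| + 1) * ‖u₁ t x - u₂ t x‖ ^ 2
            + (2 * K + 2 * σ + 1) * ‖f₁ t x - f₂ t x‖ ^ 2)) := by
        refine integral_mono (hderiv t).1 (hflux.fun_add hrhs) fun x => ?_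
        simp only [h₁.deriv_norm_sub_sq h₂ t x]
        exact add_le_add_right (energy_terms_le hμ hα hβ hσ hr hK hyoung _ _ _ _) _
    _ = _ := by
        rw [integral_add hflux hrhs,
          integral_add (hw.const_mul _) (hg.const_mul _), integral_const_mul, integral_const_mul,
          integral_finsetSum _ fun i _ => integrable_pd (hG i) (hGc i) i]
        simp only [fun i => integral_pd_eq_zero (hG i) (hGc i) i, Finset.sum_const_zero, zero_add]

end
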